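/- arXiv:2202.13909 — 2 statements merged into one kernel-verified Lean document; each statement's English description precedes it below -/
import Mathlib

section
/- Let φ(z) = (az+b)/(cz+d) (a,b,c,d ∈ ℂ, ad−bc ≠ 0) be a linear fractional self-map of the open unit disk 𝔻. Then the following are equivalent: (i) C_φ is normal on H²; (ii) C_φ is J-normal, where J = J_1; (iii) C_φ is J_μ-normal for some (equivalently every) μ ∈ ℂ with |μ| = 1. -/
open scoped ComplexConjugate InnerProductSpace ENNReal NNReal
open Complex Metric

noncomputable section

abbrev H2 : Type := lp (fun _ : ℕ => ℂ) 2

namespace H2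

/-- Evaluation of an element of `H²` (given by its sequence of Taylor coefficients)
at a point `z` of the unit disk: `f(z) = ∑ aₙ zⁿ`. -/
def eval (f : H2) (z : ℂ) : ℂ := ∑' n : ℕ, (f : ∀ _ : ℕ, ℂ) n * z ^ n

/-- The Szegő kernel function `K_w(z) = 1/(1 - conj w * z)`. -/
def ker (w z : ℂ) : ℂ := (1 - conj w * z)⁻¹

lemma kernel_memℓp (w : ℂ) (hw : ‖w‖ < 1) :
    Memℓp (fun n : ℕ => (conj w) ^ n) 2 := by
  apply memℓp_gen
  have hsum : Summable (fun n : ℕ => (‖w‖ ^ 2) ^ n) :=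
    summable_geometric_of_lt_one (by positivity) (by nlinarith [norm_nonneg w])
  refine hsum.congr fun n => ?_
  have h2 : ((2 : ℝ≥0∞).toReal) = ((2 : ℕ) : ℝ) := by simp
  rw [h2, Real.rpow_natCast]
  simp [norm_pow, ← pow_mul, Nat.mul_comm]

/-- The reproducing kernel of `H²` at `w` in the unit disk, as an element of `H²`. -/
def kernel (w : ℂ) : H2 :=
  if hw : ‖w‖ < 1 then ⟨fun n : ℕ => (conj w) ^ n, kernel_memℓp w hw⟩ else 0

/-- `T` is the composition operator `C_φ` on `H²`. -/
def IsCompOp (φ : ℂ → ℂ) (T : H2 →L[ℂ] H2) : Prop :=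
  ∀ f : H2, ∀ z : ℂ, ‖z‖ < 1 → eval (T f) z = eval f (φ z)

/-- `W` is the weighted composition operator `W_{ψ,φ}` on `H²`. -/
def IsWCompOp (ψ φ : ℂ → ℂ) (W : H2 →L[ℂ] H2) : Prop :=
  ∀ f : H2, ∀ z : ℂ, ‖z‖ < 1 → eval (W f) z = ψ z * eval f (φ z)

/-- A conjugation on `H²`: a conjugate-linear involution satisfying `⟪Cx, Cy⟫ = ⟪y, x⟫`. -/
structure IsConjugation (C : H2 → H2) : Prop where
  map_add : ∀ x y : H2, C (x + y) = C x + C y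
  map_smul : ∀ (c : ℂ) (x : H2), C (c • x) = conj c • C x
  invol : ∀ x : H2, C (C x) = x
  inner_conj : ∀ x y : H2, ⟪C x, C y⟫_ℂ = ⟪y, x⟫_ℂ

/-- `T` is `C`-normal: `C T* T C = T T*`. -/
def CNormal (C : H2 → H2) (T : H2 →L[ℂ] H2) : Prop :=
  ∀ x : H2, C ((ContinuousLinearMap.adjoint T) (T (C x)))
      = T ((ContinuousLinearMap.adjoint T) x)

/-- `T` is a normal operator: `T* T = T T*`. -/
def IsNormalOp (T : H2 →L[ℂ] H2) : Prop :=
  (ContinuousLinearMap.adjoint T).comp T = T.comp (ContinuousLinearMap.adjoint T)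

/-- `T` is a unitary operator. -/
def IsUnitaryOp (T : H2 →L[ℂ] H2) : Prop :=
  T.comp (ContinuousLinearMap.adjoint T) = ContinuousLinearMap.id ℂ H2 ∧
  (ContinuousLinearMap.adjoint T).comp T = ContinuousLinearMap.id ℂ H2

/-- `C` is the conjugation `J_μ` on `H²`: `(J_μ f)(z) = conj (f (μ * conj z))`. -/
def IsJmu (μ : ℂ) (C : H2 → H2) : Prop :=
  ∀ f : H2, ∀ z : ℂ, ‖z‖ < 1 → eval (C f) z = conj (eval f (μ * conj z))

/-- `ξ_p(z) = √(1-|p|²) / (1 - conj p * z)`. -/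
def xi (p z : ℂ) : ℂ := (Real.sqrt (1 - ‖p‖ ^ 2) : ℂ) / (1 - conj p * z)

/-- `τ_p(z) = λ (p - z) / (1 - conj p * z)`. -/
def tau (p lam z : ℂ) : ℂ := lam * (p - z) / (1 - conj p * z)

/-- `C` is the conjugation `J W_{ξ_p, τ_p}` on `H²`:
`(C f)(z) = conj (ξ_p(conj z) * f (τ_p (conj z)))`. -/
def IsJW (p lam : ℂ) (C : H2 → H2) : Prop :=
  ∀ f : H2, ∀ z : ℂ, ‖z‖ < 1 →
    eval (C f) z = conj (xi p (conj z) * eval f (tau p lam (conj z)))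

end H2

namespace H2

lemma norm_coeff_le (f : H2) (n : ℕ) : ‖f n‖ ≤ ‖f‖ :=
  lp.norm_apply_le_norm two_ne_zero f n

lemma hasSum_eval (f : H2) {z : ℂ} (hz : ‖z‖ < 1) :
    HasSum (fun n => f n * z ^ n) (eval f z) := by
  refine (Summable.of_norm_bounded (g := fun n => ‖f‖ * ‖z‖ ^ n)
    ((summable_geometric_of_lt_one (norm_nonneg z) hz).mul_left _) fun n => ?_).hasSum
  rw [norm_mul, norm_pow]
  gcongr
  exact norm_coeff_le f n

lemma hasFPowerSeriesAt_eval (f : H2) :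
    HasFPowerSeriesAt (eval f) (FormalMultilinearSeries.ofScalars ℂ (fun n => f n)) 0 := by
  rw [hasFPowerSeriesAt_iff']
  filter_upwards [ball_mem_nhds (0 : ℂ) one_pos] with z hz
  simpa [mul_comm] using hasSum_eval f (by simpa using hz)

lemma ext_eval {f g : H2} (h : ∀ z : ℂ, ‖z‖ < 1 → eval f z = eval g z) : f = g := by
  have key := (hasFPowerSeriesAt_eval f).eq_formalMultilinearSeries_of_eventually
    (hasFPowerSeriesAt_eval g) (by
      filter_upwards [ball_mem_nhds (0 : ℂ) one_pos] with z hz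
      exact h z (by simpa using hz))
  ext n
  exact congrFun (FormalMultilinearSeries.ofScalars_series_injective ℂ ℂ key) n

lemma hasDerivAt_eval (f : H2) : HasDerivAt (eval f) (f 1) 0 := by
  simpa using (hasFPowerSeriesAt_eval f).hasDerivAt

lemma eval_zero (f : H2) : eval f 0 = f 0 := by
  unfold eval
  rw [tsum_eq_single 0 fun n hn => by simp [hn]]
  simp

/-- The monomial `zⁿ`. -/
def monomial (n : ℕ) : H2 := lp.single 2 n (1 : ℂ)

lemma monomial_apply (n m : ℕ) : (monomial n : H2) m = if m = n then 1 else 0 := by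
  simp [monomial, Pi.single_apply]

lemma eval_monomial (n : ℕ) (z : ℂ) : eval (monomial n) z = z ^ n := by
  unfold eval
  rw [tsum_eq_single n fun m hm => by simp [monomial_apply, hm]]
  simp [monomial_apply]

lemma eval_smul (k : ℂ) (f : H2) (z : ℂ) : eval (k • f) z = k * eval f z := by
  simp [eval, ← tsum_mul_left, mul_assoc]

lemma norm_monomial (n : ℕ) : ‖monomial n‖ = 1 := by
  simp [monomial, lp.norm_single]

lemma inner_monomial (n : ℕ) (f : H2) : ⟪monomial n, f⟫_ℂ = f n := by
  simp [monomial, lp.inner_single_left]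

lemma inner_monomial_right (n : ℕ) (f : H2) : ⟪f, monomial n⟫_ℂ = conj (f n) := by
  rw [← inner_conj_symm, inner_monomial]

lemma eq_smul_monomial_of_norm {f : H2} {n : ℕ} (h : ‖f‖ = ‖f n‖) :
    f = f n • monomial n := by
  have h1 := norm_sub_sq (𝕜 := ℂ) f (f n • monomial n)
  rw [inner_smul_right, inner_monomial_right, Complex.mul_conj, norm_smul, norm_monomial,
    RCLike.re_eq_complex_re, ofReal_re, Complex.normSq_eq_norm_sq, h] at h1
  have h2 : ‖f - f n • monomial n‖ = 0 := by
    rw [← sq_eq_zero_iff]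
    linarith
  exact sub_eq_zero.mp (norm_eq_zero.mp h2)

variable {T : H2 →L[ℂ] H2}

lemma IsCompOp.monomial_zero {φ : ℂ → ℂ} (hT : IsCompOp φ T) :
    T (monomial 0) = monomial 0 :=
  ext_eval fun z hz => by simp [hT _ z hz, eval_monomial]

lemma IsCompOp.eval_monomial_one {φ : ℂ → ℂ} (hT : IsCompOp φ T) {z : ℂ} (hz : ‖z‖ < 1) :
    eval (T (monomial 1)) z = φ z := by
  simp [hT _ z hz, eval_monomial]

lemma adjoint_apply (f : H2) (n : ℕ) :
    (ContinuousLinearMap.adjoint T f) n = ⟪T (monomial n), f⟫_ℂ := by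
  rw [← inner_monomial, ContinuousLinearMap.adjoint_inner_right]

/-- If a composition operator fixes the origin, its symbol acts by the chain rule on
the linear Taylor coefficient. -/
lemma IsCompOp.apply_one {φ : ℂ → ℂ} (hT : IsCompOp φ T) (h0 : φ 0 = 0) (f : H2) :
    (T f) 1 = f 1 * (T (monomial 1)) 1 := by
  have hev : ∀ g : H2, eval (T g) =ᶠ[nhds 0] fun z => eval g (φ z) := fun g => by
    filter_upwards [ball_mem_nhds (0 : ℂ) one_pos] with z hz
    exact hT g z (by simpa using hz)
  have hφ : HasDerivAt φ ((T (monomial 1)) 1) 0 :=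
    (hasDerivAt_eval (T (monomial 1))).congr_of_eventuallyEq
      ((hev (monomial 1)).mono fun z hz => by simp [hz, eval_monomial])
  have hcomp : HasDerivAt (fun z => eval f (φ z)) (f 1 * (T (monomial 1)) 1) 0 :=
    HasDerivAt.comp (h₂ := eval f) 0 (by rw [h0]; exact hasDerivAt_eval f) hφ
  exact (hasDerivAt_eval (T f)).unique (hcomp.congr_of_eventuallyEq (hev f))

/-- A composition operator `T` with `‖T* zⁿ‖ = ‖T zⁿ‖` for all `n` is diagonal. -/
lemma IsCompOp.exists_diagonal {φ : ℂ → ℂ} (hT : IsCompOp φ T)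
    (hnorm : ∀ n, ‖ContinuousLinearMap.adjoint T (monomial n)‖ = ‖T (monomial n)‖) :
    ∃ α : ℂ, ∀ n, T (monomial n) = α ^ n • monomial n := by
  have hadj0 : ContinuousLinearMap.adjoint T (monomial 0) = monomial 0 := by
    have hc : (ContinuousLinearMap.adjoint T (monomial 0)) 0 = 1 := by
      rw [adjoint_apply, hT.monomial_zero, inner_monomial]
      simp [monomial_apply]
    have := eq_smul_monomial_of_norm (f := ContinuousLinearMap.adjoint T (monomial 0)) (n := 0)
      (by rw [hnorm, hT.monomial_zero, norm_monomial, hc, norm_one])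
    rwa [hc, one_smul] at this
  have h0 : φ 0 = 0 := by
    rw [← hT.eval_monomial_one (by simp), eval_zero, ← inner_monomial,
      ← ContinuousLinearMap.adjoint_inner_left, hadj0, inner_monomial]
    simp [monomial_apply]
  set α := (T (monomial 1)) 1 with hα
  have hsq : ‖ContinuousLinearMap.adjoint T (monomial 1)‖ ^ 2 = ‖α‖ ^ 2 := by
    have : ((‖ContinuousLinearMap.adjoint T (monomial 1)‖ : ℂ)) ^ 2 = (‖α‖ : ℂ) ^ 2 := by
      rw [← Complex.mul_conj']
      have := inner_self_eq_norm_sq_to_K (𝕜 := ℂ) (ContinuousLinearMap.adjoint T (monomial 1))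
      rw [ContinuousLinearMap.adjoint_inner_left, inner_monomial, hT.apply_one h0,
        adjoint_apply, inner_monomial_right] at this
      rw [mul_comm]
      exact this.symm
    exact_mod_cast this
  have hone : T (monomial 1) = α • monomial 1 := by
    refine eq_smul_monomial_of_norm ?_
    rw [← hnorm]
    exact (pow_left_inj₀ (norm_nonneg _) (norm_nonneg _) two_ne_zero).mp hsq
  refine ⟨α, fun n => ext_eval fun z hz => ?_⟩
  rw [hT _ z hz, ← hT.eval_monomial_one hz, hone, eval_smul, eval_smul, eval_monomial,
    eval_monomial, eval_monomial]
  ring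

lemma adjoint_apply_of_diagonal {α : ℂ}
    (hα : ∀ n, T (monomial n) = α ^ n • monomial n) (f : H2) (n : ℕ) :
    (ContinuousLinearMap.adjoint T f) n = conj α ^ n * f n := by
  rw [adjoint_apply, hα, inner_smul_left, inner_monomial, map_pow]

lemma apply_of_diagonal {α : ℂ}
    (hα : ∀ n, T (monomial n) = α ^ n • monomial n) (f : H2) (n : ℕ) : (T f) n = α ^ n * f n := by
  have h : ContinuousLinearMap.adjoint T (monomial n) = conj α ^ n • monomial n := by
    ext m
    rw [adjoint_apply_of_diagonal hα]
    by_cases hm : m = n <;> simp [monomial_apply, hm]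
  rw [← inner_monomial, ← ContinuousLinearMap.adjoint_inner_left, h, inner_smul_left,
    inner_monomial]
  simp

lemma isNormalOp_of_diagonal {α : ℂ}
    (hα : ∀ n, T (monomial n) = α ^ n • monomial n) : IsNormalOp T := by
  refine ContinuousLinearMap.ext fun f => ?_
  ext n
  simp only [ContinuousLinearMap.comp_apply, adjoint_apply_of_diagonal hα, apply_of_diagonal hα]
  ring

section Conjugation

variable {C : H2 → H2} {μ : ℂ}

lemma IsJmu.map_monomial (hJ : IsJmu μ C) (n : ℕ) :
    C (monomial n) = conj μ ^ n • monomial n :=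
  ext_eval fun z hz => by
    rw [hJ _ z hz, eval_smul, eval_monomial, eval_monomial]
    simp [mul_pow]

lemma IsJmu.apply (hJ : IsJmu μ C) (hC : IsConjugation C) (f : H2) (n : ℕ) :
    (C f) n = conj μ ^ n * conj (f n) := by
  have h := hC.inner_conj (C (monomial n)) f
  rw [hC.invol, inner_monomial, hJ.map_monomial, inner_smul_right, inner_monomial_right] at h
  exact h

lemma cNormal_of_diagonal {α : ℂ} (hα : ∀ n, T (monomial n) = α ^ n • monomial n)
    (hμ : ‖μ‖ = 1) (hJ : IsJmu μ C) (hC : IsConjugation C) : CNormal C T := by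
  intro f
  ext n
  have h : conj μ ^ n * μ ^ n = 1 := by
    rw [← mul_pow, mul_comm, Complex.mul_conj', hμ]
    simp
  simp only [hJ.apply hC, adjoint_apply_of_diagonal hα, apply_of_diagonal hα, map_mul,
    map_pow, conj_conj]
  linear_combination (α ^ n * conj α ^ n * f n) * h

lemma CNormal.norm_adjoint (hC : IsConjugation C) (h : CNormal C T) (f : H2) :
    ‖ContinuousLinearMap.adjoint T f‖ = ‖T (C f)‖ := by
  have h1 : ⟪ContinuousLinearMap.adjoint T f, ContinuousLinearMap.adjoint T f⟫_ℂ
      = ⟪T (C f), T (C f)⟫_ℂ := by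
    rw [ContinuousLinearMap.adjoint_inner_left, ← h f]
    conv_lhs => rw [← hC.invol f]
    rw [hC.inner_conj, hC.invol, ContinuousLinearMap.adjoint_inner_left]
  rw [inner_self_eq_norm_sq_to_K, inner_self_eq_norm_sq_to_K] at h1
  have h2 : ‖ContinuousLinearMap.adjoint T f‖ ^ 2 = ‖T (C f)‖ ^ 2 := by exact_mod_cast h1
  exact (pow_left_inj₀ (norm_nonneg _) (norm_nonneg _) two_ne_zero).mp h2

lemma CNormal.norm_adjoint_monomial (hμ : ‖μ‖ = 1) (hJ : IsJmu μ C) (hC : IsConjugation C)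
    (h : CNormal C T) (n : ℕ) :
    ‖ContinuousLinearMap.adjoint T (monomial n)‖ = ‖T (monomial n)‖ := by
  rw [h.norm_adjoint hC, hJ.map_monomial, map_smul, norm_smul, norm_pow, RCLike.norm_conj,
    hμ, one_pow, one_mul]

lemma IsNormalOp.norm_adjoint (h : IsNormalOp T) (f : H2) :
    ‖ContinuousLinearMap.adjoint T f‖ = ‖T f‖ := by
  have h1 : ⟪ContinuousLinearMap.adjoint T f, ContinuousLinearMap.adjoint T f⟫_ℂ
      = ⟪T f, T f⟫_ℂ := by
    rw [ContinuousLinearMap.adjoint_inner_left, ← ContinuousLinearMap.comp_apply, ← h,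
      ContinuousLinearMap.comp_apply, ContinuousLinearMap.adjoint_inner_right]
  rw [inner_self_eq_norm_sq_to_K, inner_self_eq_norm_sq_to_K] at h1
  have h2 : ‖ContinuousLinearMap.adjoint T f‖ ^ 2 = ‖T f‖ ^ 2 := by exact_mod_cast h1
  exact (pow_left_inj₀ (norm_nonneg _) (norm_nonneg _) two_ne_zero).mp h2

lemma isConjugation_star : IsConjugation (star : H2 → H2) where
  map_add := star_add
  map_smul c x := star_smul c x
  invol := star_star
  inner_conj x y := by
    rw [lp.inner_eq_tsum, lp.inner_eq_tsum]
    exact tsum_congr fun n => by simp [mul_comm]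

lemma isJmu_one_star : IsJmu 1 (star : H2 → H2) := fun f z _ => by
  simp [eval, Complex.conj_tsum]

end Conjugation

end H2

/-- Let `φ(z) = (az+b)/(cz+d)` be a linear fractional self-map of the unit disk. Then the
following are equivalent: (i) `C_φ` is normal; (ii) `C_φ` is `J`-normal (`J = J_1`);
(iii) `C_φ` is `J_μ`-normal for every (equivalently, some) `μ` with `|μ| = 1`. -/
theorem stmt1 (a b c d : ℂ) (φ : ℂ → ℂ)
    (hφ : ∀ z : ℂ, φ z = (a * z + b) / (c * z + d))
    (hdet : a * d - b * c ≠ 0)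
    (hden : ∀ z : ℂ, ‖z‖ < 1 → c * z + d ≠ 0)
    (hself : ∀ z : ℂ, ‖z‖ < 1 → ‖φ z‖ < 1)
    (T : H2 →L[ℂ] H2) (hT : H2.IsCompOp φ T) :
    List.TFAE
      [H2.IsNormalOp T,
       ∀ C : H2 → H2, H2.IsConjugation C → H2.IsJmu 1 C → H2.CNormal C T,
       ∀ μ : ℂ, ‖μ‖ = 1 →
         ∀ C : H2 → H2, H2.IsConjugation C → H2.IsJmu μ C → H2.CNormal C T,
       ∃ μ : ℂ, ‖μ‖ = 1 ∧
         ∃ C : H2 → H2, H2.IsConjugation C ∧ H2.IsJmu μ C ∧ H2.CNormal C T] := by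
  tfae_have 1 → 3 := fun h μ hμ C hC hJ => by
    obtain ⟨α, hα⟩ := hT.exists_diagonal fun n => h.norm_adjoint _
    exact H2.cNormal_of_diagonal hα hμ hJ hC
  tfae_have 3 → 2 := fun h => h 1 norm_one
  tfae_have 2 → 4 := fun h =>
    ⟨1, norm_one, star, H2.isConjugation_star, H2.isJmu_one_star,
      h star H2.isConjugation_star H2.isJmu_one_star⟩
  tfae_have 4 → 1 := by
    rintro ⟨μ, hμ, C, hC, hJ, h⟩
    obtain ⟨α, hα⟩ := hT.exists_diagonal (h.norm_adjoint_monomial hμ hJ hC)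
    exact H2.isNormalOp_of_diagonal hα
  tfae_finish
end
end

section
/- Let φ be an analytic self-map of 𝔻 and ψ analytic on 𝔻 such that W_{ψ,φ} is bounded on H². Then W_{ψ,φ} is unitary on H² if and only if φ is an automorphism of 𝔻 and ψ = γ·K_q/‖K_q‖ where q ∈ 𝔻 is the point with φ(q) = 0 and γ ∈ ℂ with |γ| = 1. -/
open scoped ComplexConjugate InnerProductSpace ENNReal NNReal
open Complex Metric

noncomputable section

namespace H2

lemma eval_eq_inner (f : H2) {w : ℂ} (hw : ‖w‖ < 1) : eval f w = ⟪kernel w, f⟫_ℂ := by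
  rw [lp.inner_eq_tsum, eval]
  refine tsum_congr fun n => ?_
  simp [kernel, hw]

lemma eval_kernel {w z : ℂ} (hw : ‖w‖ < 1) (hz : ‖z‖ < 1) : eval (kernel w) z = ker w z := by
  have h : ‖conj w * z‖ < 1 := by
    rw [norm_mul, RCLike.norm_conj]
    nlinarith [norm_nonneg w, norm_nonneg z]
  rw [ker, ← tsum_geometric_of_norm_lt_one h, eval]
  refine tsum_congr fun n => ?_
  simp [kernel, hw, mul_pow]

lemma eval_smul_of_norm_lt_one (c : ℂ) (f : H2) {z : ℂ} (hz : ‖z‖ < 1) :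
    eval (c • f) z = c * eval f z := by
  rw [eval_eq_inner _ hz, eval_eq_inner _ hz, inner_smul_right]

lemma eval_sub_of_norm_lt_one (f g : H2) {z : ℂ} (hz : ‖z‖ < 1) :
    eval (f - g) z = eval f z - eval g z := by
  rw [eval_eq_inner _ hz, eval_eq_inner _ hz, eval_eq_inner _ hz, inner_sub_right]

/-- An element of `H²` vanishing on the disk is zero. -/
lemma eq_zero_of_eval_eq_zero {f : H2} (h : ∀ z : ℂ, ‖z‖ < 1 → eval f z = 0) : f = 0 := by
  set p := FormalMultilinearSeries.ofScalars ℂ (f : ∀ _ : ℕ, ℂ) with hp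
  have hr : (1 : ℝ≥0∞) ≤ p.radius := by
    have := p.le_radius_of_bound (r := 1) ‖f‖ fun n => by
      simpa [hp, FormalMultilinearSeries.ofScalars, norm_smul] using
        lp.norm_apply_le_norm (by norm_num) f n
    simpa using this
  have hs := (p.hasFPowerSeriesOnBall (lt_of_lt_of_le one_pos hr)).hasFPowerSeriesAt
  have h0 : p = 0 := by
    refine hs.eq_zero_of_eventually ?_
    filter_upwards [Metric.ball_mem_nhds (0 : ℂ) one_pos] with z hz
    refine Eq.trans ?_ (h z (by simpa using hz))
    simp [FormalMultilinearSeries.sum, eval, hp, mul_comm]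
  rw [hp, FormalMultilinearSeries.ofScalars_series_eq_zero] at h0
  ext n
  simpa using congrFun h0 n

section WeightedComposition

variable {φ ψ : ℂ → ℂ} {W : H2 →L[ℂ] H2}

/-- The adjoint of a weighted composition operator maps kernels to multiples of kernels. -/
lemma IsWCompOp.adjoint_kernel (hW : IsWCompOp ψ φ W)
    (hself : ∀ z : ℂ, ‖z‖ < 1 → ‖φ z‖ < 1) {w : ℂ} (hw : ‖w‖ < 1) :
    ContinuousLinearMap.adjoint W (kernel w) = conj (ψ w) • kernel (φ w) := by
  refine ext_inner_right ℂ fun f => ?_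
  rw [ContinuousLinearMap.adjoint_inner_left, ← eval_eq_inner _ hw, hW f w hw, inner_smul_left,
    ← eval_eq_inner _ (hself w hw), RingHomCompTriple.comp_apply, RingHom.id_apply]

/-- A weighted composition operator is a co-isometry iff it preserves the Szegő kernel. -/
lemma IsWCompOp.comp_adjoint_eq_id_iff (hW : IsWCompOp ψ φ W)
    (hself : ∀ z : ℂ, ‖z‖ < 1 → ‖φ z‖ < 1) :
    W.comp (ContinuousLinearMap.adjoint W) = ContinuousLinearMap.id ℂ H2 ↔
      ∀ w z : ℂ, ‖w‖ < 1 → ‖z‖ < 1 → ψ z * (conj (ψ w) * ker (φ w) (φ z)) = ker w z := by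
  have key : ∀ w z : ℂ, ‖w‖ < 1 → ‖z‖ < 1 →
      eval (W (ContinuousLinearMap.adjoint W (kernel w))) z =
        ψ z * (conj (ψ w) * ker (φ w) (φ z)) := fun w z hw hz => by
    rw [hW _ z hz, hW.adjoint_kernel hself hw, eval_smul_of_norm_lt_one _ _ (hself z hz),
      eval_kernel (hself w hw) (hself z hz)]
  constructor
  · intro h w z hw hz
    have := congrArg (fun T : H2 →L[ℂ] H2 => T (kernel w)) h
    simp only [ContinuousLinearMap.comp_apply, ContinuousLinearMap.id_apply] at this
    rw [← key w z hw hz, this, eval_kernel hw hz]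
  · intro h
    have hk : ∀ w : ℂ, ‖w‖ < 1 → W (ContinuousLinearMap.adjoint W (kernel w)) = kernel w :=
      fun w hw => ext_eval fun z hz => by rw [key w z hw hz, h w z hw hz, eval_kernel hw hz]
    ext1 f
    refine ext_eval fun z hz => ?_
    rw [ContinuousLinearMap.comp_apply, ContinuousLinearMap.id_apply, eval_eq_inner _ hz,
      eval_eq_inner _ hz, ← ContinuousLinearMap.adjoint_inner_left,
      ContinuousLinearMap.adjoint_inner_right, hk z hz]

/-- A co-isometric weighted composition operator whose symbol is onto the disk and whose weight
does not vanish is unitary. -/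
lemma IsWCompOp.isUnitaryOp_of_comp_adjoint_eq_id (hW : IsWCompOp ψ φ W)
    (hsurj : Set.SurjOn φ (Metric.ball (0 : ℂ) 1) (Metric.ball (0 : ℂ) 1))
    (hψ : ∀ z : ℂ, ‖z‖ < 1 → ψ z ≠ 0)
    (h : W.comp (ContinuousLinearMap.adjoint W) = ContinuousLinearMap.id ℂ H2) :
    IsUnitaryOp W := by
  refine ⟨h, ?_⟩
  ext1 f
  refine ext_eval fun v hv => ?_
  obtain ⟨z, hz, rfl⟩ := hsurj (mem_ball_zero_iff.2 hv)
  rw [mem_ball_zero_iff] at hz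
  refine mul_left_cancel₀ (hψ z hz) ?_
  rw [← hW _ z hz, ← hW _ z hz]
  have := congrArg (fun T : H2 →L[ℂ] H2 => T (W f)) h
  simp only [ContinuousLinearMap.comp_apply, ContinuousLinearMap.id_apply] at this ⊢
  rw [this]

end WeightedComposition

lemma one_sub_conj_mul_ne_zero {w z : ℂ} (hw : ‖w‖ < 1) (hz : ‖z‖ < 1) :
    1 - conj w * z ≠ 0 := by
  intro h
  have h1 : ‖conj w * z‖ = 1 := by rw [← sub_eq_zero.1 h, norm_one]
  rw [norm_mul, RCLike.norm_conj] at h1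
  nlinarith [norm_nonneg w, norm_nonneg z]

lemma one_sub_conj_tau_mul_tau {p w z : ℂ} (hp : ‖p‖ < 1) (hw : ‖w‖ < 1) (hz : ‖z‖ < 1) :
    1 - conj (tau p 1 w) * tau p 1 z =
      (1 - conj p * p) * (1 - conj w * z) / (conj (1 - conj p * w) * (1 - conj p * z)) := by
  have h1 := one_sub_conj_mul_ne_zero hp hz
  have h2 := one_sub_conj_mul_ne_zero hw hp
  simp only [tau, map_div₀, map_mul, map_sub, map_one, Complex.conj_conj, mul_comm p (conj w)]
  field_simp
  ring

lemma norm_tau_lt_one {p z : ℂ} (hp : ‖p‖ < 1) (hz : ‖z‖ < 1) : ‖tau p 1 z‖ < 1 := by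
  have h := one_sub_conj_tau_mul_tau hp hz hz
  simp only [Complex.conj_mul'] at h
  have h' : 1 - ‖tau p 1 z‖ ^ 2 = (1 - ‖p‖ ^ 2) * (1 - ‖z‖ ^ 2) / ‖1 - conj p * z‖ ^ 2 := by
    exact_mod_cast h
  have hd : 0 < ‖1 - conj p * z‖ := norm_pos_iff.2 (one_sub_conj_mul_ne_zero hp hz)
  have h1 : 0 < 1 - ‖p‖ ^ 2 := by nlinarith [norm_nonneg p]
  have h2 : 0 < 1 - ‖z‖ ^ 2 := by nlinarith [norm_nonneg z]
  have : 0 < 1 - ‖tau p 1 z‖ ^ 2 := h' ▸ by positivity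
  nlinarith [norm_nonneg (tau p 1 z)]

lemma tau_tau {p z : ℂ} (hp : ‖p‖ < 1) (hz : ‖z‖ < 1) : tau p 1 (tau p 1 z) = z := by
  have h1 := one_sub_conj_mul_ne_zero hp hz
  have h3 := one_sub_conj_mul_ne_zero hp hp
  have ht : tau p 1 z * (1 - conj p * z) = p - z := by
    rw [tau, div_mul_cancel₀ _ h1, one_mul]
  have h4 : 1 - conj p * tau p 1 z = (1 - conj p * p) / (1 - conj p * z) := by
    rw [eq_div_iff h1]
    linear_combination -conj p * ht
  rw [tau, h4, div_eq_iff (div_ne_zero h3 h1), mul_div_assoc', eq_div_iff h1]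
  linear_combination -ht

lemma differentiableOn_tau {p : ℂ} (hp : ‖p‖ < 1) :
    DifferentiableOn ℂ (tau p 1) (Metric.ball 0 1) := by
  refine DifferentiableOn.div (by fun_prop) (by fun_prop) fun z hz => ?_
  exact one_sub_conj_mul_ne_zero hp (mem_ball_zero_iff.1 hz)

lemma mapsTo_tau {p : ℂ} (hp : ‖p‖ < 1) :
    Set.MapsTo (tau p 1) (Metric.ball 0 1) (Metric.ball 0 1) := fun z hz => by
  rw [mem_ball_zero_iff] at hz ⊢
  exact norm_tau_lt_one hp hz

lemma tau_self (p : ℂ) : tau p 1 p = 0 := by simp [tau]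

lemma tau_zero (p : ℂ) : tau p 1 0 = p := by simp [tau]

end H2

section Inverse

open Filter Topology

/-- The inverse of an injective holomorphic function on an open set is holomorphic. -/
lemma differentiableAt_of_leftInvOn {f g : ℂ → ℂ} {U V : Set ℂ} (hU : IsOpen U) (hV : IsOpen V)
    (hf : DifferentiableOn ℂ f U) (hgU : Set.MapsTo g V U) (hinj : Set.InjOn f U)
    (hfg : Set.RightInvOn g f V) {v : ℂ} (hv : v ∈ V) : DifferentiableAt ℂ g v := by
  have hfan : ∀ z ∈ U, AnalyticAt ℂ f z := fun z hz => hf.analyticAt (hU.mem_nhds hz)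
  have hcont : ∀ v ∈ V, ContinuousAt g v := by
    intro v hv
    have hvU := hgU hv
    have hmap : 𝓝 v ≤ map f (𝓝 (g v)) := by
      rcases (hfan _ hvU).eventually_constant_or_nhds_le_map_nhds with h | h
      · exfalso
        have h' : ∀ᶠ z in 𝓝[≠] (g v), f z = f (g v) ∧ z ∈ U :=
          (h.and (hU.mem_nhds hvU)).filter_mono nhdsWithin_le_nhds
        obtain ⟨z, ⟨hz1, hz2⟩, hz3⟩ := (h'.and self_mem_nhdsWithin).exists
        exact hz3 (hinj hz2 hvU hz1)
      · rwa [hfg hv] at h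
    intro s hs
    have hs' : f '' (s ∩ U) ∈ 𝓝 v :=
      hmap (image_mem_map (inter_mem hs (hU.mem_nhds hvU)))
    rw [mem_map]
    filter_upwards [hs', hV.mem_nhds hv] with w hw hwV
    obtain ⟨z, ⟨hzs, hzU⟩, rfl⟩ := hw
    have : g (f z) = z := hinj (hgU hwV) hzU (hfg hwV)
    rwa [Set.mem_preimage, this]
  have hdiff : ∀ v ∈ V, deriv f (g v) ≠ 0 → DifferentiableAt ℂ g v := fun v hv h =>
    (HasStrictDerivAt.of_local_left_inverse (hcont v hv)
      (hfan _ (hgU hv)).hasStrictDerivAt h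
      (by filter_upwards [hV.mem_nhds hv] with w hw using hfg hw)).hasDerivAt.differentiableAt
  refine (analyticAt_of_differentiable_on_punctured_nhds_of_continuousAt ?_
    (hcont v hv)).differentiableAt
  have hne : ∀ᶠ z in 𝓝[≠] (g v), deriv f z ≠ 0 := by
    refine (hfan _ (hgU hv)).deriv.eventually_eq_zero_or_eventually_ne_zero.resolve_left ?_
    intro h
    obtain ⟨r, hr, hball⟩ := Metric.eventually_nhds_iff_ball.1 (h.and (hU.mem_nhds (hgU hv)))
    have hconst : ∀ z ∈ Metric.ball (g v) r, f z = f (g v) := fun z hz =>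
      Metric.isOpen_ball.is_const_of_deriv_eq_zero (convex_ball _ _).isPreconnected
        (hf.mono fun z hz => (hball z hz).2) (fun z hz => (hball z hz).1) hz
        (Metric.mem_ball_self hr)
    obtain ⟨z, hz, hzne⟩ := ((eventually_nhdsWithin_of_eventually_nhds
      (Metric.ball_mem_nhds (g v) hr)).and (self_mem_nhdsWithin (s := {g v}ᶜ))).exists
    exact hzne (hinj (hball z hz).2 (hgU hv) (hconst z hz))
  have htend : Tendsto g (𝓝[≠] v) (𝓝[≠] (g v)) := by
    refine tendsto_nhdsWithin_iff.2 ⟨(hcont v hv).mono_left nhdsWithin_le_nhds, ?_⟩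
    filter_upwards [self_mem_nhdsWithin, nhdsWithin_le_nhds (hV.mem_nhds hv)] with w hw hwV h
    exact hw (by rw [Set.mem_singleton_iff, ← hfg hwV, ← hfg hv, h])
  filter_upwards [htend.eventually hne, nhdsWithin_le_nhds (hV.mem_nhds hv)] with w h1 h2
  exact hdiff w h2 h1

end Inverse

namespace H2

/-- A holomorphic bijection of the disk vanishing at `q` is a rotation of `τ_q`. -/
lemma exists_eq_mul_tau_of_bijOn {φ : ℂ → ℂ} {q : ℂ}
    (hφ : DifferentiableOn ℂ φ (Metric.ball (0 : ℂ) 1))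
    (hbij : Set.BijOn φ (Metric.ball (0 : ℂ) 1) (Metric.ball (0 : ℂ) 1))
    (hq : ‖q‖ < 1) (hφq : φ q = 0) :
    ∃ c : ℂ, ‖c‖ = 1 ∧ ∀ z : ℂ, ‖z‖ < 1 → φ z = c * tau q 1 z := by
  set D := Metric.ball (0 : ℂ) 1
  have hqD : q ∈ D := mem_ball_zero_iff.2 hq
  set η := Function.invFunOn φ D
  have hηD : Set.MapsTo η D D := hbij.surjOn.mapsTo_invFunOn
  have hφη : Set.RightInvOn η φ D := hbij.surjOn.rightInvOn_invFunOn
  have hηφ : Set.LeftInvOn η φ D := hbij.injOn.leftInvOn_invFunOn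
  have hη : DifferentiableOn ℂ η D := fun v hv =>
    (differentiableAt_of_leftInvOn isOpen_ball isOpen_ball hφ hηD hbij.injOn hφη
      hv).differentiableWithinAt
  have hg : DifferentiableOn ℂ (φ ∘ tau q 1) D :=
    hφ.comp (differentiableOn_tau hq) (mapsTo_tau hq)
  have hgD : Set.MapsTo (φ ∘ tau q 1) D D := hbij.mapsTo.comp (mapsTo_tau hq)
  have hg0 : (φ ∘ tau q 1) 0 = 0 := by simp [tau_zero, hφq]
  have hh : DifferentiableOn ℂ (tau q 1 ∘ η) D := (differentiableOn_tau hq).comp hη hηD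
  have hhD : Set.MapsTo (tau q 1 ∘ η) D D := (mapsTo_tau hq).comp hηD
  have hh0 : (tau q 1 ∘ η) 0 = 0 := by
    have hη0 : η 0 = q := by simpa only [hφq] using hηφ hqD
    rw [Function.comp_apply, hη0, tau_self]
  have hnorm : ∀ z ∈ D, ‖(φ ∘ tau q 1) z‖ = ‖z‖ := by
    intro z hz
    refine le_antisymm (norm_le_norm_of_mapsTo_ball hg
      (hgD.mono_right ball_subset_closedBall) hg0 (mem_ball_zero_iff.1 hz)) ?_
    have := norm_le_norm_of_mapsTo_ball hh (hhD.mono_right ball_subset_closedBall) hh0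
      (mem_ball_zero_iff.1 (hgD hz))
    rwa [Function.comp_apply, Function.comp_apply, hηφ (mapsTo_tau hq hz),
      tau_tau hq (mem_ball_zero_iff.1 hz)] at this
  have hhalf : (1 / 2 : ℂ) ∈ D := mem_ball_zero_iff.2 (by norm_num)
  obtain ⟨c, hc, hgc⟩ := affine_of_mapsTo_ball_of_exists_norm_dslope_eq_div' (R₂ := 1) hg
    (by rw [hg0]; exact hgD.mono_right ball_subset_closedBall)
    ⟨1 / 2, hhalf, by
      rw [dslope_of_ne _ (by norm_num), slope_def_field, hg0, sub_zero, sub_zero, norm_div,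
        hnorm _ hhalf]
      norm_num⟩
  refine ⟨c, by simpa using hc, fun z hz => ?_⟩
  have := hgc (mapsTo_tau hq (mem_ball_zero_iff.2 hz))
  simp only [Function.comp_apply, tau_tau hq hz] at this
  rw [this, tau_zero, hφq]
  simp [mul_comm]

/-- If `φ` and a weight `ψ` preserve the Szegő kernel, then `φ` is an automorphism of the disk. -/
lemma bijOn_of_one_sub_eq {φ ψ : ℂ → ℂ} (hself : ∀ z : ℂ, ‖z‖ < 1 → ‖φ z‖ < 1)
    (h : ∀ w z : ℂ, ‖w‖ < 1 → ‖z‖ < 1 →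
      (1 - conj w * z) * (ψ z * conj (ψ w)) = 1 - conj (φ w) * φ z) :
    Set.BijOn φ (Metric.ball (0 : ℂ) 1) (Metric.ball (0 : ℂ) 1) := by
  have h0 : ‖(0 : ℂ)‖ < 1 := by simp
  set a := φ 0 with ha_def
  have ha : ‖a‖ < 1 := hself 0 h0
  set b : ℂ → ℂ := fun z => tau a 1 (φ z) with hb
  have hbz : ∀ z, ‖z‖ < 1 → ψ z * conj (ψ 0) = 1 - conj a * φ z := fun z hz => by
    simpa using h 0 z h0 hz
  have hbb : ∀ w z : ℂ, ‖w‖ < 1 → ‖z‖ < 1 → conj (b w) * b z = conj w * z := by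
    intro w z hw hz
    have h1 := one_sub_conj_tau_mul_tau ha (hself w hw) (hself z hz)
    have hnw := one_sub_conj_mul_ne_zero ha (hself w hw)
    have hnz := one_sub_conj_mul_ne_zero ha (hself z hz)
    rw [← hbz w hw] at hnw h1
    rw [← hbz z hz] at hnz h1
    rw [← h w z hw hz, ← hbz 0 h0] at h1
    have hψw := left_ne_zero_of_mul hnw
    have hψz := left_ne_zero_of_mul hnz
    have hψ0 := right_ne_zero_of_mul hnz
    have hψ0' : ψ 0 ≠ 0 := by simpa using hψ0
    have hψw' : conj (ψ w) ≠ 0 := by simpa using hψw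
    rw [map_mul, Complex.conj_conj] at h1
    have h2 : ψ 0 * conj (ψ 0) * ((1 - conj w * z) * (ψ z * conj (ψ w))) /
        (conj (ψ w) * ψ 0 * (ψ z * conj (ψ 0))) = 1 - conj w * z := by
      field_simp
    rw [h2] at h1
    exact sub_right_injective h1
  have hhalf : ‖(1 / 2 : ℂ)‖ < 1 := by norm_num
  set c : ℂ := 2 * b (1 / 2) with hc
  have hcc : conj c * c = 1 := by
    have := hbb _ _ hhalf hhalf
    simp only [hc, map_mul, map_ofNat, map_div₀, map_one] at this ⊢
    linear_combination 4 * this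
  have hcb : ∀ z : ℂ, ‖z‖ < 1 → b z = c * z := by
    intro z hz
    have := hbb _ z hhalf hz
    have h3 : conj c * b z = z := by
      simp only [hc, map_mul, map_ofNat, map_div₀, map_one] at this ⊢
      linear_combination 2 * this
    linear_combination c * h3 - b z * hcc
  have hφb : ∀ z : ℂ, ‖z‖ < 1 → φ z = tau a 1 (c * z) := fun z hz => by
    rw [← hcb z hz, hb, tau_tau ha (hself z hz)]
  have hcn : ‖c‖ = 1 := by
    rw [Complex.conj_mul'] at hcc
    have : ‖c‖ ^ 2 = 1 := by exact_mod_cast hcc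
    exact (pow_eq_one_iff_of_nonneg (norm_nonneg c) two_ne_zero).1 this
  refine ⟨fun z hz => ?_, fun z hz w hw hzw => ?_, fun v hv => ?_⟩
  · rw [mem_ball_zero_iff] at hz ⊢
    exact hself z hz
  · rw [mem_ball_zero_iff] at hz hw
    have h4 : c * z = c * w := by
      rw [← hcb z hz, ← hcb w hw]
      exact congrArg (tau a 1) hzw
    exact mul_left_cancel₀ (norm_ne_zero_iff.1 (by rw [hcn]; exact one_ne_zero)) h4
  · rw [mem_ball_zero_iff] at hv
    have hz : ‖conj c * tau a 1 v‖ < 1 := by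
      rw [norm_mul, RCLike.norm_conj, hcn, one_mul]
      exact norm_tau_lt_one ha hv
    refine ⟨_, mem_ball_zero_iff.2 hz, ?_⟩
    rw [hφb _ hz, ← mul_assoc, mul_comm c, hcc, one_mul, tau_tau ha hv]

end H2

/-- Lemma (Bourdon–Narayan): `W_{ψ,φ}` is unitary on `H²` iff `φ` is an automorphism of `𝔻`
and `ψ = γ K_q / ‖K_q‖` where `φ(q) = 0` and `|γ| = 1`. -/
theorem stmt17 (φ ψ : ℂ → ℂ)
    (hφa : DifferentiableOn ℂ φ (Metric.ball (0 : ℂ) 1))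
    (hself : ∀ z : ℂ, ‖z‖ < 1 → ‖φ z‖ < 1)
    (hψa : DifferentiableOn ℂ ψ (Metric.ball (0 : ℂ) 1))
    (W : H2 →L[ℂ] H2) (hW : H2.IsWCompOp ψ φ W) :
    H2.IsUnitaryOp W ↔
      (Set.BijOn φ (Metric.ball (0 : ℂ) 1) (Metric.ball (0 : ℂ) 1) ∧
        ∃ q γ : ℂ, ‖q‖ < 1 ∧ ‖γ‖ = 1 ∧ φ q = 0 ∧
          ∀ z : ℂ, ‖z‖ < 1 →
            ψ z = γ * (Real.sqrt (1 - ‖q‖ ^ 2) : ℂ) / (1 - conj q * z)) := by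
  rw [H2.IsUnitaryOp]
  constructor
  · rintro ⟨h, -⟩
    rw [hW.comp_adjoint_eq_id_iff hself] at h
    have h' : ∀ w z : ℂ, ‖w‖ < 1 → ‖z‖ < 1 →
        (1 - conj w * z) * (ψ z * conj (ψ w)) = 1 - conj (φ w) * φ z := by
      intro w z hw hz
      have h1 := h w z hw hz
      have h2 := H2.one_sub_conj_mul_ne_zero hw hz
      have h3 := H2.one_sub_conj_mul_ne_zero (hself w hw) (hself z hz)
      rw [H2.ker, H2.ker] at h1
      field_simp at h1
      linear_combination h1
    have hbij := H2.bijOn_of_one_sub_eq hself h'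
    obtain ⟨q, hq, hφq⟩ := hbij.surjOn (Metric.mem_ball_self one_pos)
    rw [mem_ball_zero_iff] at hq
    have hψq : ∀ z : ℂ, ‖z‖ < 1 → (1 - conj q * z) * (ψ z * conj (ψ q)) = 1 := fun z hz => by
      simpa [hφq] using h' q z hq hz
    have hne : conj (ψ q) ≠ 0 := fun h0 => by simpa [h0] using hψq q hq
    have hpos : 0 < 1 - ‖q‖ ^ 2 := by nlinarith [norm_nonneg q]
    have hs : (Real.sqrt (1 - ‖q‖ ^ 2) : ℂ) ≠ 0 := by
      exact_mod_cast (Real.sqrt_pos.2 hpos).ne'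
    refine ⟨hbij, q, (conj (ψ q) * (Real.sqrt (1 - ‖q‖ ^ 2) : ℂ))⁻¹, hq, ?_, hφq, fun z hz => ?_⟩
    · have h1 := hψq q hq
      rw [Complex.conj_mul', Complex.mul_conj'] at h1
      have h2 : (1 - ‖q‖ ^ 2) * ‖ψ q‖ ^ 2 = 1 := by exact_mod_cast h1
      rw [norm_inv, norm_mul, RCLike.norm_conj, Complex.norm_real, Real.norm_eq_abs,
        abs_of_nonneg (Real.sqrt_nonneg _), inv_eq_one]
      refine (pow_eq_one_iff_of_nonneg (by positivity) two_ne_zero).1 ?_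
      rw [mul_pow, Real.sq_sqrt hpos.le, mul_comm, h2]
    · have h1 := hψq z hz
      have h2 := H2.one_sub_conj_mul_ne_zero hq hz
      field_simp
      linear_combination h1
  · rintro ⟨hbij, q, γ, hq, hγ, hφq, hψ⟩
    obtain ⟨c, hc, hφc⟩ := H2.exists_eq_mul_tau_of_bijOn hφa hbij hq hφq
    have hpos : 0 < 1 - ‖q‖ ^ 2 := by nlinarith [norm_nonneg q]
    have hs : (Real.sqrt (1 - ‖q‖ ^ 2) : ℂ) ≠ 0 := by
      exact_mod_cast (Real.sqrt_pos.2 hpos).ne'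
    have hss : (Real.sqrt (1 - ‖q‖ ^ 2) : ℂ) * (Real.sqrt (1 - ‖q‖ ^ 2) : ℂ) =
        1 - conj q * q := by
      rw [Complex.conj_mul']
      exact_mod_cast Real.mul_self_sqrt hpos.le
    have hγγ : γ * conj γ = 1 := by rw [Complex.mul_conj', hγ]; norm_num
    have hcc : conj c * c = 1 := by rw [Complex.conj_mul', hc]; norm_num
    refine hW.isUnitaryOp_of_comp_adjoint_eq_id hbij.surjOn (fun z hz => ?_) ?_
    · rw [hψ z hz]
      exact div_ne_zero (mul_ne_zero (norm_ne_zero_iff.1 (by rw [hγ]; exact one_ne_zero)) hs)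
        (H2.one_sub_conj_mul_ne_zero hq hz)
    · rw [hW.comp_adjoint_eq_id_iff hself]
      intro w z hw hz
      have h1 : 1 - conj (φ w) * φ z = 1 - conj (H2.tau q 1 w) * H2.tau q 1 z := by
        rw [hφc w hw, hφc z hz, map_mul]
        linear_combination -(conj (H2.tau q 1 w) * H2.tau q 1 z) * hcc
      have hqw : conj (1 - conj q * w) ≠ 0 :=
        (map_ne_zero _).2 (H2.one_sub_conj_mul_ne_zero hq hw)
      have hqz := H2.one_sub_conj_mul_ne_zero hq hz
      have hwz := H2.one_sub_conj_mul_ne_zero hw hz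
      have hqq := H2.one_sub_conj_mul_ne_zero hq hq
      rw [H2.ker, H2.ker, h1, H2.one_sub_conj_tau_mul_tau hq hw hz, hψ z hz, hψ w hw, map_div₀,
        map_mul, Complex.conj_ofReal, ← hss]
      field_simp
      linear_combination (1 - conj w * z)⁻¹ * hγγ
end
end
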